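/- arXiv:2310.06402 — 2 statements merged into one kernel-verified Lean document; each statement's English description precedes it below -/
import Mathlib

section
/- Assume ρ̂ = ρ + αλ_min − ζ̃_{L*−K} ≥ 0, let γ ∈ Γ, let ε₂ ∈ (0, (1 − κ_K²γ²(1 + γ/(2β)))/(1 − κ_K²γ²)), and set ε₁ = 1 − κ_K²γ²(1 + γ/(2β(1 − ε₂))). Then for every z ∈ H and every z* ∈ Fix V^γ, ‖V^γ z − z*‖² ≤ ‖z − z*‖² − ε₁‖J_{γC} z − R^γ z‖² − (2βε₂/γ)‖J_{γC} z − z + z* − J_{γC} z*‖². -/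
open Filter Topology
open scoped RealInnerProductSpace Pointwise

noncomputable section

variable {H G : Type*}

/-- A set-valued operator `A` is `ρ`-monotone. -/
def IsMonotoneSV [NormedAddCommGroup H] [InnerProductSpace ℝ H]
    (ρ : ℝ) (A : H → Set H) : Prop :=
  ∀ x y u v, u ∈ A x → v ∈ A y → ρ * ‖x - y‖ ^ 2 ≤ ⟪x - y, u - v⟫

/-- `A` is maximally `ρ`-monotone: it is `ρ`-monotone and its graph is maximal, under
inclusion, among graphs of `ρ`-monotone operators. -/
def IsMaxMonotoneSV [NormedAddCommGroup H] [InnerProductSpace ℝ H]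
    (ρ : ℝ) (A : H → Set H) : Prop :=
  IsMonotoneSV ρ A ∧
    ∀ A' : H → Set H, IsMonotoneSV ρ A' → (∀ x, A x ⊆ A' x) → ∀ x, A' x = A x

/-- `C` is `β`-cocoercive. -/
def IsCocoercive [NormedAddCommGroup H] [InnerProductSpace ℝ H]
    (β : ℝ) (C : H → H) : Prop :=
  ∀ x y, β * ‖C x - C y‖ ^ 2 ≤ ⟪x - y, C x - C y⟫

/-- `k` is a Lipschitz bound for `f`. -/
def IsLipBound {E F : Type*} [NormedAddCommGroup E] [NormedAddCommGroup F]
    (k : ℝ) (f : E → F) : Prop :=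
  ∀ x y, ‖f x - f y‖ ≤ k * ‖x - y‖

/-- `k` is the (smallest) Lipschitz constant of `f`. -/
def IsLipConst {E F : Type*} [NormedAddCommGroup E] [NormedAddCommGroup F]
    (k : ℝ) (f : E → F) : Prop :=
  IsLipBound k f ∧ ∀ k', IsLipBound k' f → k ≤ k'

/-- A single-valued map `B` is monotone. -/
def IsMonotoneMap [NormedAddCommGroup G] [InnerProductSpace ℝ G]
    (B : G → G) : Prop :=
  ∀ x y, (0:ℝ) ≤ ⟪x - y, B x - B y⟫

/-- The operator `D_M : x ↦ α M (L x - c) + M (B (L x))`. -/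
def Dop [NormedAddCommGroup H] [InnerProductSpace ℝ H]
    [NormedAddCommGroup G] [InnerProductSpace ℝ G]
    (α : ℝ) (L : H →L[ℝ] G) (c : G) (B : G → G) (M : G →L[ℝ] H) : H → H :=
  fun x => α • M (L x - c) + M (B (L x))

/-- `λ_min = inf {⟪x, K (L x)⟫ : ‖x‖ = 1}`. -/
def lambdaMin [NormedAddCommGroup H] [InnerProductSpace ℝ H]
    [NormedAddCommGroup G] [InnerProductSpace ℝ G]
    (L : H →L[ℝ] G) (K : G →L[ℝ] H) : ℝ :=
  sInf {r : ℝ | ∃ x : H, ‖x‖ = 1 ∧ r = ⟪x, K (L x)⟫}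

/-- The step-size bound `χ`. -/
def chiConst (β ρ κ : ℝ) : ℝ :=
  if 0 ≤ ρ then 4 * β / (1 + Real.sqrt (1 + 16 * β ^ 2 * κ ^ 2))
  else min (4 * β / (1 + Real.sqrt (1 + 16 * β ^ 2 * κ ^ 2))) (-1 / ρ)


/-- The infimum `lambdaMin L K` bounds the quadratic form `x ↦ ⟪x, K (L x)⟫` from below. -/
theorem lambdaMin_mul_norm_sq_le [NormedAddCommGroup H] [InnerProductSpace ℝ H]
    [NormedAddCommGroup G] [InnerProductSpace ℝ G]
    (L : H →L[ℝ] G) (K : G →L[ℝ] H) (x : H) :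
    lambdaMin L K * ‖x‖ ^ 2 ≤ ⟪x, K (L x)⟫ := by
  rcases eq_or_ne x 0 with rfl | hx
  · simp
  have hn : 0 < ‖x‖ := norm_pos_iff.mpr hx
  have hbdd : BddBelow {r : ℝ | ∃ x : H, ‖x‖ = 1 ∧ r = ⟪x, K (L x)⟫} := by
    refine ⟨-‖K.comp L‖, ?_⟩
    rintro r ⟨y, hy, rfl⟩
    have h1 := abs_real_inner_le_norm y (K (L y))
    have h2 := (K.comp L).le_opNorm y
    rw [ContinuousLinearMap.comp_apply] at h2
    rw [hy] at h1 h2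
    linarith [(abs_le.mp h1).1]
  have h : lambdaMin L K ≤ ⟪‖x‖⁻¹ • x, K (L (‖x‖⁻¹ • x))⟫ :=
    csInf_le hbdd ⟨_, by rw [norm_smul, norm_inv, norm_norm, inv_mul_cancel₀ hn.ne'], rfl⟩
  simp only [map_smul, inner_smul_left, inner_smul_right, RCLike.conj_to_real] at h
  calc lambdaMin L K * ‖x‖ ^ 2
      ≤ ‖x‖⁻¹ * (‖x‖⁻¹ * ⟪x, K (L x)⟫) * ‖x‖ ^ 2 := by gcongr
    _ = ⟪x, K (L x)⟫ := by field_simp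

theorem Dop_sub_Dop [NormedAddCommGroup H] [InnerProductSpace ℝ H]
    [NormedAddCommGroup G] [InnerProductSpace ℝ G]
    (α : ℝ) (L : H →L[ℝ] G) (c : G) (B : G → G) (M : G →L[ℝ] H) (x y : H) :
    Dop α L c B M x - Dop α L c B M y
      = α • M (L (x - y)) + M (B (L x) - B (L y)) := by
  simp only [Dop, map_sub, smul_sub]
  abel

/-- `D_M` has the same Lipschitz bounds as `x ↦ M (α (L x) + B (L x))`. -/
theorem IsLipBound.dop [NormedAddCommGroup H] [InnerProductSpace ℝ H]
    [NormedAddCommGroup G] [InnerProductSpace ℝ G]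
    {α : ℝ} {L : H →L[ℝ] G} {B : G → G} {M : G →L[ℝ] H} {κ : ℝ}
    (h : IsLipBound κ (fun x : H => M (α • L x + B (L x)))) (c : G) :
    IsLipBound κ (Dop α L c B M) := by
  intro x y
  convert h x y using 2
  rw [Dop_sub_Dop]
  simp only [map_add, map_sub, map_smul, smul_sub]
  abel

/-- `D_K` is `(α λ_min - ζt)`-monotone when `B` is monotone. -/
theorem le_inner_Dop_sub_Dop [NormedAddCommGroup H] [InnerProductSpace ℝ H] [CompleteSpace H]
    [NormedAddCommGroup G] [InnerProductSpace ℝ G] [CompleteSpace G]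
    {α ζt : ℝ} {L : H →L[ℝ] G} {B : G → G} {K : G →L[ℝ] H} (c : G)
    (hα : 0 ≤ α) (hB : IsMonotoneMap B)
    (hζt : IsLipBound ζt (fun x : H => (ContinuousLinearMap.adjoint L - K) (B (L x))))
    (x y : H) :
    (α * lambdaMin L K - ζt) * ‖x - y‖ ^ 2
      ≤ ⟪x - y, Dop α L c B K x - Dop α L c B K y⟫ := by
  have h1 := mul_le_mul_of_nonneg_left (lambdaMin_mul_norm_sq_le L K (x - y)) hα
  have h2 := hB (L x) (L y)
  rw [← map_sub, ← ContinuousLinearMap.adjoint_inner_right] at h2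
  have h3 := (real_inner_le_norm (x - y) _).trans
    (mul_le_mul_of_nonneg_left (hζt x y) (norm_nonneg (x - y)))
  rw [← map_sub, sub_apply, inner_sub_right] at h3
  rw [Dop_sub_Dop, inner_add_right, inner_smul_right]
  linarith

/-- If `f` has a Lipschitz constant `k` with `γ² k² < 1`, then `Id - γ f` is injective. -/
theorem IsLipBound.injective_sub_smul {E : Type*} [NormedAddCommGroup E] [NormedSpace ℝ E]
    {k γ : ℝ} {f : E → E} (hf : IsLipBound k f) (hk : k ^ 2 * γ ^ 2 < 1) :
    Function.Injective (fun x => x - γ • f x) := by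
  intro x y hxy
  have h : x - y = γ • (f x - f y) := by
    have hxy' : x - γ • f x = y - γ • f y := hxy
    rw [smul_sub, sub_eq_sub_iff_add_eq_add]
    rw [sub_eq_sub_iff_add_eq_add] at hxy'
    rw [hxy', add_comm]
  have h1 : ‖x - y‖ ^ 2 = γ ^ 2 * ‖f x - f y‖ ^ 2 := by
    rw [h, norm_smul, mul_pow, Real.norm_eq_abs, sq_abs]
  have h2 : ‖f x - f y‖ ^ 2 ≤ k ^ 2 * ‖x - y‖ ^ 2 := by
    rw [← mul_pow]
    exact pow_le_pow_left₀ (norm_nonneg _) (hf x y) 2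
  have h3 := mul_le_mul_of_nonneg_left h2 (sq_nonneg γ)
  have h4 : ‖x - y‖ ^ 2 = 0 := by nlinarith [sq_nonneg ‖x - y‖]
  exact sub_eq_zero.mp (norm_eq_zero.mp (pow_eq_zero_iff two_ne_zero |>.mp h4))

/-- Young's inequality for the inner product. -/
theorem two_mul_real_inner_le [NormedAddCommGroup H] [InnerProductSpace ℝ H]
    {t : ℝ} (ht : 0 < t) (x y : H) : 2 * ⟪x, y⟫ ≤ t * ‖x‖ ^ 2 + ‖y‖ ^ 2 / t := by
  have h1 := real_inner_le_norm x y
  have h2 : t * ‖x‖ ^ 2 + ‖y‖ ^ 2 / t - 2 * (‖x‖ * ‖y‖) = (t * ‖x‖ - ‖y‖) ^ 2 / t := by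
    field_simp
    ring
  have h3 : 0 ≤ (t * ‖x‖ - ‖y‖) ^ 2 / t := by positivity
  linarith

/-- The one-step estimate behind the contraction property: `d`, `e`, `p`, `δ` are the
increments of `J_{γC}`, of `C`, of `J_{γC} - R^γ` and of `D_K`. -/
theorem norm_sq_step_le [NormedAddCommGroup H] [InnerProductSpace ℝ H]
    {β γ κ ε : ℝ} (hβ : 0 < β) (hγ : 0 < γ) (hε : ε < 1) {d e p δ : H}
    (hC : β * ‖e‖ ^ 2 ≤ ⟪d, e⟫) (hδ : ‖δ‖ ≤ κ * ‖p‖)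
    (hQ : 0 ≤ ⟪d - p, p - γ • e - γ • δ⟫) :
    ‖d - (p - γ • e - γ • δ)‖ ^ 2 ≤ ‖d + γ • e‖ ^ 2
      - (1 - κ ^ 2 * γ ^ 2 * (1 + γ / (2 * β * (1 - ε)))) * ‖p‖ ^ 2
      - 2 * β * ε / γ * ‖γ • e‖ ^ 2 := by
  have hε' : 0 < 1 - ε := by linarith
  have hδ2 : ‖δ‖ ^ 2 ≤ κ ^ 2 * ‖p‖ ^ 2 := by
    rw [← mul_pow]
    exact pow_le_pow_left₀ (norm_nonneg _) hδ 2
  have hY := two_mul_real_inner_le (t := 2 * β * (1 - ε) / γ) (by positivity) e δ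
  have hY' : γ ^ 2 * (2 * ⟪e, δ⟫)
      ≤ 2 * β * (1 - ε) * γ * ‖e‖ ^ 2 + γ ^ 2 * (γ / (2 * β * (1 - ε))) * ‖δ‖ ^ 2 := by
    refine (mul_le_mul_of_nonneg_left hY (sq_nonneg γ)).trans_eq ?_
    field_simp
  have hδ3 : γ ^ 2 * (1 + γ / (2 * β * (1 - ε))) * ‖δ‖ ^ 2
      ≤ γ ^ 2 * (1 + γ / (2 * β * (1 - ε))) * (κ ^ 2 * ‖p‖ ^ 2) := by
    gcongr
  have hC' := mul_le_mul_of_nonneg_left hC hγ.le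
  have hlast : 2 * β * ε / γ * ‖γ • e‖ ^ 2 = 2 * β * ε * γ * ‖e‖ ^ 2 := by
    rw [norm_smul, Real.norm_of_nonneg hγ.le]
    field_simp
  have hexp : ‖d - (p - γ • e - γ • δ)‖ ^ 2 = ‖d + γ • e‖ ^ 2 - 2 * (γ * ⟪d, e⟫)
      - 2 * ⟪d - p, p - γ • e - γ • δ⟫ - ‖p‖ ^ 2 + γ ^ 2 * (2 * ⟪e, δ⟫)
      + γ ^ 2 * ‖δ‖ ^ 2 := by
    simp only [← real_inner_self_eq_norm_sq, inner_sub_left, inner_sub_right, inner_add_left,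
      inner_add_right, real_inner_smul_left, real_inner_smul_right]
    rw [real_inner_comm d p, real_inner_comm d e, real_inner_comm d δ, real_inner_comm p e,
      real_inner_comm p δ, real_inner_comm e δ]
    ring
  rw [hlast, hexp]
  linarith

theorem statement15 {H G : Type*} [NormedAddCommGroup H] [InnerProductSpace ℝ H] [CompleteSpace H]
    [NormedAddCommGroup G] [InnerProductSpace ℝ G] [CompleteSpace G]
    (ρ β ζ α : ℝ) (A : H → Set H) (C : H → H) (B : G → G)
    (L : H →L[ℝ] G) (K : G →L[ℝ] H) (c : G)
    (hA : IsMaxMonotoneSV ρ A)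
    (hβ : 0 < β) (hC : IsCocoercive β C)
    (hζ : 0 < ζ) (hBmono : IsMonotoneMap B) (hBlip : IsLipBound ζ B)
    (hα : 0 ≤ α)
    (ζt : ℝ)
    (hζt : IsLipConst ζt (fun x : H => (ContinuousLinearMap.adjoint L - K) (B (L x))))
    (κ : ℝ) (hκ : IsLipConst κ (fun x : H => K (α • L x + B (L x))))
    (hρhat : 0 ≤ (ρ + α * lambdaMin L K - ζt))
    (γ : ℝ) (hγ0 : 0 < γ)
    (hΓ₁ : κ ^ 2 * γ ^ 2 * (1 + γ / (2 * β)) < 1) (hΓ₂ : ρ * γ > -1)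
    (ε₂ : ℝ) (hε₂a : 0 < ε₂)
    (hε₂b : ε₂ < (1 - κ ^ 2 * γ ^ 2 * (1 + γ / (2 * β))) / (1 - κ ^ 2 * γ ^ 2))
    (ε₁ : ℝ) (hε₁ : ε₁ = 1 - κ ^ 2 * γ ^ 2 * (1 + γ / (2 * β * (1 - ε₂))))
    (J JC : H → H) (hJ : ∀ x y : H, J x = y ↔ x - y ∈ γ • A y)
    (hJC : ∀ x y : H, JC x = y ↔ x = y + γ • C y)
    (R V : H → H)
    (hRdef : ∀ z, R z = J ((2:ℝ) • JC z - z - γ • Dop α L c B K (JC z)))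
    (hVdef : ∀ z, V z = R z - γ • Dop α L c B K (R z) + z -
      (JC z - γ • Dop α L c B K (JC z))) :
    ∀ z zs : H, V zs = zs →
      ‖V z - zs‖ ^ 2 ≤ ‖z - zs‖ ^ 2 - ε₁ * ‖JC z - R z‖ ^ 2 -
        (2 * β * ε₂ / γ) * ‖JC z - z + zs - JC zs‖ ^ 2 := by
  intro z zs hzs
  set D := Dop α L c B K with hD
  have hDlip : IsLipBound κ D := hκ.1.dop c
  have hκγ : κ ^ 2 * γ ^ 2 < 1 := by
    have h : 0 ≤ κ ^ 2 * γ ^ 2 * (γ / (2 * β)) := by positivity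
    linarith
  have hε₂ : ε₂ < 1 := by
    refine hε₂b.trans_le ((div_le_one (by linarith)).mpr ?_)
    have h : 0 ≤ κ ^ 2 * γ ^ 2 * (γ / (2 * β)) := by positivity
    linarith
  have hfix : R zs = JC zs := by
    refine hDlip.injective_sub_smul hκγ ?_
    have h := (hVdef zs).symm.trans hzs
    rwa [add_sub_right_comm, add_eq_right, sub_eq_zero] at h
  have hz : z = JC z + γ • C (JC z) := (hJC z _).mp rfl
  have hzs' : zs = JC zs + γ • C (JC zs) := (hJC zs _).mp rfl
  obtain ⟨a, ha, hae⟩ := (hJ _ _).mp (hRdef z).symm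
  obtain ⟨b, hb, hbe⟩ := (hJ _ _).mp (hRdef zs).symm
  simp only [hfix] at hb hbe
  have hmono := hA.1 _ _ _ _ ha hb
  have hDmono := le_inner_Dop_sub_Dop c hα hBmono hζt.1 (R z) (JC zs)
  rw [← hD] at hDmono
  have hV := hVdef z
  set x := JC z
  set w := R z
  set y := JC zs
  have hQeq : γ • ((a - b) + (D w - D y))
      = (x - w) - γ • (C x - C y) - γ • (D x - D w) := by
    simp only [smul_add, smul_sub]
    simp only at hae hbe
    rw [hae, hbe]
    nth_rewrite 1 [hz, hzs']
    module
  have hQ : 0 ≤ ⟪(x - y) - (x - w), (x - w) - γ • (C x - C y) - γ • (D x - D w)⟫ := by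
    rw [← hQeq, sub_sub_sub_cancel_left, real_inner_smul_right, inner_add_right]
    have h := mul_nonneg hρhat (sq_nonneg ‖w - y‖)
    exact mul_nonneg hγ0.le (by linarith)
  have key := norm_sq_step_le hβ hγ0 hε₂ (hC x y) (hDlip x w) hQ
  have e1 : V z - zs = (x - y) - ((x - w) - γ • (C x - C y) - γ • (D x - D w)) := by
    rw [hV]
    nth_rewrite 1 [hz, hzs']
    module
  have e2 : z - zs = (x - y) + γ • (C x - C y) := by
    nth_rewrite 1 [hz, hzs']
    module
  have e3 : x - z + zs - y = -(γ • (C x - C y)) := by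
    nth_rewrite 1 [hz, hzs']
    module
  rw [e1, e2, e3, norm_neg, hε₁]
  exact key
end
end

section
/- Assume ρ̂ = ρ + αλ_min − ζ̃_{L*−K} > 0, let γ ∈ Γ, let ε₂ ∈ (0, (1 − κ_K²γ²(1 + γ/(2β)))/(1 − κ_K²γ²)), and set ε₁ = 1 − κ_K²γ²(1 + γ/(2β(1 − ε₂))). Then for every z ∈ H and every z* ∈ Fix V^γ, ‖V^γ z − z*‖ ≤ √(1 − (1/3)·min{2βε₂/γ, ε₁, 2γρ̂}) · ‖z − z*‖. -/
open Filter Topology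
open scoped RealInnerProductSpace Pointwise

noncomputable section

variable {H G : Type*}

/-- The quadratic form of `K ∘ L` is bounded below by `lambdaMin L K`. -/
theorem lambdaMin_mul_sq_le {H G : Type*} [NormedAddCommGroup H] [InnerProductSpace ℝ H]
    [NormedAddCommGroup G] [InnerProductSpace ℝ G] (L : H →L[ℝ] G) (K : G →L[ℝ] H) (x : H) :
    lambdaMin L K * ‖x‖ ^ 2 ≤ ⟪x, K (L x)⟫ := by
  rcases eq_or_ne x 0 with rfl | hx
  · simp
  have hn : 0 < ‖x‖ := norm_pos_iff.mpr hx
  have hbdd : BddBelow {r : ℝ | ∃ x : H, ‖x‖ = 1 ∧ r = ⟪x, K (L x)⟫} := by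
    refine ⟨-‖K ∘L L‖, ?_⟩
    rintro r ⟨u, hu, rfl⟩
    have h1 := abs_real_inner_le_norm u (K (L u))
    have h2 := (K ∘L L).le_opNorm u
    rw [ContinuousLinearMap.comp_apply] at h2
    rw [hu] at h1 h2
    linarith [neg_abs_le ⟪u, K (L u)⟫]
  have h := csInf_le hbdd ⟨‖x‖⁻¹ • x, norm_smul_inv_norm (𝕜 := ℝ) hx, rfl⟩
  rw [map_smul, map_smul, real_inner_smul_left, real_inner_smul_right] at h
  calc lambdaMin L K * ‖x‖ ^ 2 ≤ ‖x‖⁻¹ * (‖x‖⁻¹ * ⟪x, K (L x)⟫) * ‖x‖ ^ 2 := by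
        gcongr
        exact h
    _ = ⟪x, K (L x)⟫ := by field_simp

/-- Strong (possibly hypo-) monotonicity of `Dop`. -/
theorem Dop_mul_sq_le_inner {H G : Type*} [NormedAddCommGroup H] [InnerProductSpace ℝ H]
    [CompleteSpace H] [NormedAddCommGroup G] [InnerProductSpace ℝ G] [CompleteSpace G]
    {α ζt : ℝ} {B : G → G} {L : H →L[ℝ] G} {K : G →L[ℝ] H} (c : G)
    (hB : IsMonotoneMap B) (hα : 0 ≤ α)
    (hζt : IsLipBound ζt (fun x : H => (ContinuousLinearMap.adjoint L - K) (B (L x))))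
    (x y : H) :
    (α * lambdaMin L K - ζt) * ‖x - y‖ ^ 2 ≤ ⟪x - y, Dop α L c B K x - Dop α L c B K y⟫ := by
  set w := B (L x) - B (L y) with hw
  have hD : Dop α L c B K x - Dop α L c B K y = α • K (L (x - y)) + K w := by
    simp only [Dop, hw, map_sub, smul_sub]
    abel
  have hlam := mul_le_mul_of_nonneg_left (lambdaMin_mul_sq_le L K (x - y)) hα
  have hmono : 0 ≤ ⟪x - y, ContinuousLinearMap.adjoint L w⟫ := by
    rw [ContinuousLinearMap.adjoint_inner_right, map_sub]
    exact hB _ _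
  have hlip : ‖(ContinuousLinearMap.adjoint L - K) w‖ ≤ ζt * ‖x - y‖ := by
    rw [hw, map_sub]
    exact hζt x y
  have hcs := real_inner_le_norm (x - y) ((ContinuousLinearMap.adjoint L - K) w)
  have hcs' := mul_le_mul_of_nonneg_left hlip (norm_nonneg (x - y))
  rw [sub_apply, inner_sub_right] at hcs
  rw [sub_apply] at hcs'
  rw [hD, inner_add_right, real_inner_smul_right]
  linarith

/-- `Dop` inherits the Lipschitz bound of its translation-free part. -/
theorem norm_Dop_sub_sq_le {H G : Type*} [NormedAddCommGroup H] [InnerProductSpace ℝ H]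
    [NormedAddCommGroup G] [InnerProductSpace ℝ G]
    {α κ : ℝ} {B : G → G} {L : H →L[ℝ] G} {K : G →L[ℝ] H} (c : G)
    (hκ : IsLipBound κ (fun x : H => K (α • L x + B (L x)))) (x y : H) :
    ‖Dop α L c B K x - Dop α L c B K y‖ ^ 2 ≤ κ ^ 2 * ‖x - y‖ ^ 2 := by
  have hD : Dop α L c B K x - Dop α L c B K y
      = K (α • L x + B (L x)) - K (α • L y + B (L y)) := by
    simp only [Dop, map_sub, map_add, map_smul, smul_sub]
    abel
  rw [hD, ← mul_pow]
  exact pow_le_pow_left₀ (norm_nonneg _) (hκ x y) 2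

/-- The norm estimate behind one step of the splitting iteration: with `δ` a Young parameter,
the decrease from `a + w` to `b + w + s` controls `‖b‖²`, `‖w‖²` and `‖a - b‖²`. -/
theorem norm_sq_add_add_le {H : Type*} [NormedAddCommGroup H] [InnerProductSpace ℝ H]
    {a b w s : H} {σ η δ t m : ℝ} (hδ : 0 < δ)
    (hb : σ * ‖b‖ ^ 2 ≤ ⟪b, a - b - w - s⟫) (hw : η * ‖w‖ ^ 2 ≤ ⟪a, w⟫)
    (hs : ‖s‖ ^ 2 ≤ t * ‖a - b‖ ^ 2) (hm : 0 ≤ m) (hm₁ : m ≤ 2 * σ) (hm₂ : m ≤ 2 * η - δ)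
    (hm₃ : m ≤ 1 - t * (1 + 1 / δ)) :
    ‖b + w + s‖ ^ 2 ≤ (1 - 1 / 3 * m) * ‖a + w‖ ^ 2 := by
  have young : 2 * ⟪w, s⟫ ≤ δ * ‖w‖ ^ 2 + 1 / δ * ‖s‖ ^ 2 := by
    have h := mul_nonneg (one_div_pos.mpr hδ).le (sq_nonneg ‖δ • w - s‖)
    rw [norm_sub_sq_real, norm_smul, real_inner_smul_left, Real.norm_of_nonneg hδ.le] at h
    have e : 1 / δ * ((δ * ‖w‖) ^ 2 - 2 * (δ * ⟪w, s⟫) + ‖s‖ ^ 2)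
        = δ * ‖w‖ ^ 2 - 2 * ⟪w, s⟫ + 1 / δ * ‖s‖ ^ 2 := by
      field_simp
    linarith
  have hs' := mul_le_mul_of_nonneg_left hs (by positivity : 0 ≤ 1 + 1 / δ)
  have key : ‖a + w‖ ^ 2 - ‖b + w + s‖ ^ 2
      = 2 * ⟪b, a - b - w - s⟫ + 2 * ⟪a, w⟫ - 2 * ⟪w, s⟫ - ‖s‖ ^ 2 + ‖a - b‖ ^ 2 := by
    simp only [← real_inner_self_eq_norm_sq, inner_add_left, inner_add_right, inner_sub_left,
      inner_sub_right]
    rw [real_inner_comm a b, real_inner_comm w a, real_inner_comm w b, real_inner_comm s b,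
      real_inner_comm s w]
    ring
  have split : ‖a + w‖ ^ 2 ≤ 3 * (‖b‖ ^ 2 + ‖w‖ ^ 2 + ‖a - b‖ ^ 2) := by
    have h : ‖a + w‖ ≤ ‖b‖ + ‖w‖ + ‖a - b‖ := by
      have e : a + w = b + w + (a - b) := by abel
      rw [e]
      exact norm_add₃_le
    have h2 := pow_le_pow_left₀ (norm_nonneg _) h 2
    nlinarith [sq_nonneg (‖b‖ - ‖w‖), sq_nonneg (‖b‖ - ‖a - b‖), sq_nonneg (‖w‖ - ‖a - b‖)]
  have h0 := mul_le_mul_of_nonneg_left split hm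
  have h1 := mul_le_mul_of_nonneg_right hm₁ (sq_nonneg ‖b‖)
  have h2 := mul_le_mul_of_nonneg_right hm₂ (sq_nonneg ‖w‖)
  have h3 := mul_le_mul_of_nonneg_right hm₃ (sq_nonneg ‖a - b‖)
  linarith

theorem statement16 {H G : Type*} [NormedAddCommGroup H] [InnerProductSpace ℝ H] [CompleteSpace H]
    [NormedAddCommGroup G] [InnerProductSpace ℝ G] [CompleteSpace G]
    (ρ β ζ α : ℝ) (A : H → Set H) (C : H → H) (B : G → G)
    (L : H →L[ℝ] G) (K : G →L[ℝ] H) (c : G)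
    (hA : IsMaxMonotoneSV ρ A)
    (hβ : 0 < β) (hC : IsCocoercive β C)
    (hζ : 0 < ζ) (hBmono : IsMonotoneMap B) (hBlip : IsLipBound ζ B)
    (hα : 0 ≤ α)
    (ζt : ℝ)
    (hζt : IsLipConst ζt (fun x : H => (ContinuousLinearMap.adjoint L - K) (B (L x))))
    (κ : ℝ) (hκ : IsLipConst κ (fun x : H => K (α • L x + B (L x))))
    (hρhat : 0 < (ρ + α * lambdaMin L K - ζt))
    (γ : ℝ) (hγ0 : 0 < γ)
    (hΓ₁ : κ ^ 2 * γ ^ 2 * (1 + γ / (2 * β)) < 1) (hΓ₂ : ρ * γ > -1)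
    (ε₂ : ℝ) (hε₂a : 0 < ε₂)
    (hε₂b : ε₂ < (1 - κ ^ 2 * γ ^ 2 * (1 + γ / (2 * β))) / (1 - κ ^ 2 * γ ^ 2))
    (ε₁ : ℝ) (hε₁ : ε₁ = 1 - κ ^ 2 * γ ^ 2 * (1 + γ / (2 * β * (1 - ε₂))))
    (J JC : H → H) (hJ : ∀ x y : H, J x = y ↔ x - y ∈ γ • A y)
    (hJC : ∀ x y : H, JC x = y ↔ x = y + γ • C y)
    (R V : H → H)
    (hRdef : ∀ z, R z = J ((2:ℝ) • JC z - z - γ • Dop α L c B K (JC z)))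
    (hVdef : ∀ z, V z = R z - γ • Dop α L c B K (R z) + z -
      (JC z - γ • Dop α L c B K (JC z))) :
    ∀ z zs : H, V zs = zs →
      ‖V z - zs‖ ≤
        Real.sqrt (1 - (1 / 3) *
          min (min (2 * β * ε₂ / γ) ε₁) (2 * γ * (ρ + α * lambdaMin L K - ζt))) * ‖z - zs‖ := by
  intro z zs hzs
  have mono := Dop_mul_sq_le_inner c hBmono hα hζt.1
  have lip := norm_Dop_sub_sq_le c hκ.1
  set D := Dop α L c B K
  have hJC' : ∀ z, z = JC z + γ • C (JC z) := fun z => (hJC z _).mp rfl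
  have hR : ∀ z, ∃ u ∈ A (R z), γ • u = JC z - γ • C (JC z) - γ • D (JC z) - R z := by
    intro z
    obtain ⟨u, hu, hu'⟩ := Set.mem_smul_set.mp ((hJ _ _).mp (hRdef z).symm)
    refine ⟨u, hu, hu'.trans ?_⟩
    nth_rewrite 2 [hJC' z]
    rw [two_smul]
    abel
  have ht0 : 0 ≤ κ ^ 2 * γ ^ 2 := by positivity
  have hr : 0 < γ / (2 * β) := by positivity
  have ht1 : κ ^ 2 * γ ^ 2 < 1 := by nlinarith
  have hfix : R zs = JC zs := by
    have h := hVdef zs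
    rw [hzs] at h
    have h' : R zs - JC zs = γ • (D (R zs) - D (JC zs)) := by
      rw [smul_sub, ← sub_eq_zero]
      rw [← sub_eq_zero] at h
      rw [← neg_eq_zero, ← h]
      abel
    have h2 : ‖R zs - JC zs‖ ^ 2 ≤ κ ^ 2 * γ ^ 2 * ‖R zs - JC zs‖ ^ 2 := by
      nth_rewrite 1 [h']
      rw [norm_smul, mul_pow, Real.norm_of_nonneg hγ0.le]
      nlinarith [mul_le_mul_of_nonneg_left (lip (R zs) (JC zs)) (sq_nonneg γ)]
    have h3 : ‖R zs - JC zs‖ ^ 2 = 0 :=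
      le_antisymm (by nlinarith [sq_nonneg ‖R zs - JC zs‖]) (sq_nonneg _)
    exact sub_eq_zero.mp (norm_eq_zero.mp (pow_eq_zero_iff two_ne_zero |>.mp h3))
  have hε : ε₂ * (1 - κ ^ 2 * γ ^ 2) < 1 - κ ^ 2 * γ ^ 2 * (1 + γ / (2 * β)) :=
    (lt_div_iff₀ (sub_pos.mpr ht1)).mp hε₂b
  have hε₂1 : 0 < 1 - ε₂ := by
    by_contra! hcon
    nlinarith [mul_nonneg ht0 hr.le]
  have hfrac : γ / (2 * β * (1 - ε₂)) = γ / (2 * β) / (1 - ε₂) := by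
    rw [div_div]
  have hε₁0 : 0 ≤ ε₁ := by
    have e : ε₁ = (1 - κ ^ 2 * γ ^ 2 * (1 + γ / (2 * β)) - ε₂ * (1 - κ ^ 2 * γ ^ 2))
        / (1 - ε₂) := by
      rw [hε₁, hfrac]
      field_simp
      ring
    rw [e]
    exact div_nonneg (by linarith) hε₂1.le
  set m := min (min (2 * β * ε₂ / γ) ε₁) (2 * γ * (ρ + α * lambdaMin L K - ζt))
  have hm0 : 0 ≤ m := le_min (le_min (by positivity) hε₁0) (by positivity)
  obtain ⟨u, hu, hu'⟩ := hR z
  obtain ⟨v, hv, hv'⟩ := hR zs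
  rw [hfix] at hv hv'
  have hAm := mul_le_mul_of_nonneg_left (hA.1 _ _ _ _ hu hv) hγ0.le
  have hDm := mul_le_mul_of_nonneg_left (mono (R z) (JC zs)) hγ0.le
  rw [← real_inner_smul_right] at hAm hDm
  have hb : γ * (ρ + α * lambdaMin L K - ζt) * ‖R z - JC zs‖ ^ 2 ≤
      ⟪R z - JC zs, (JC z - JC zs) - (R z - JC zs) - γ • (C (JC z) - C (JC zs))
        - γ • (D (JC z) - D (R z))⟫ := by
    have e : (JC z - JC zs) - (R z - JC zs) - γ • (C (JC z) - C (JC zs))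
        - γ • (D (JC z) - D (R z)) = γ • (u - v) + γ • (D (R z) - D (JC zs)) := by
      rw [smul_sub γ u v, hu', hv']
      simp only [smul_sub]
      abel
    rw [e, inner_add_right]
    linarith
  have hw : β / γ * ‖γ • (C (JC z) - C (JC zs))‖ ^ 2 ≤
      ⟪JC z - JC zs, γ • (C (JC z) - C (JC zs))⟫ := by
    rw [norm_smul, real_inner_smul_right, Real.norm_of_nonneg hγ0.le]
    calc _ = γ * (β * ‖C (JC z) - C (JC zs)‖ ^ 2) := by field_simp
      _ ≤ _ := mul_le_mul_of_nonneg_left (hC _ _) hγ0.le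
  have hs : ‖γ • (D (JC z) - D (R z))‖ ^ 2 ≤
      κ ^ 2 * γ ^ 2 * ‖(JC z - JC zs) - (R z - JC zs)‖ ^ 2 := by
    rw [sub_sub_sub_cancel_right, norm_smul, mul_pow, Real.norm_of_nonneg hγ0.le]
    nlinarith [mul_le_mul_of_nonneg_left (lip (JC z) (R z)) (sq_nonneg γ)]
  have hδ : 0 < 2 * β * (1 - ε₂) / γ := by positivity
  have main := norm_sq_add_add_le hδ hb hw hs hm0
    ((min_le_right _ _).trans_eq (by ring))
    (((min_le_left _ _).trans (min_le_left _ _)).trans_eq (by ring))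
    (((min_le_left _ _).trans (min_le_right _ _)).trans_eq (by rw [hε₁, one_div_div]))
  have e₁ : V z - zs = (R z - JC zs) + γ • (C (JC z) - C (JC zs)) + γ • (D (JC z) - D (R z)) := by
    rw [hVdef z]
    linear_combination (norm := module) hJC' z - hJC' zs
  have e₂ : z - zs = (JC z - JC zs) + γ • (C (JC z) - C (JC zs)) := by
    linear_combination (norm := module) hJC' z - hJC' zs
  rw [← e₁, ← e₂] at main
  calc ‖V z - zs‖ ≤ Real.sqrt ((1 - 1 / 3 * m) * ‖z - zs‖ ^ 2) := Real.le_sqrt_of_sq_le main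
    _ = Real.sqrt (1 - 1 / 3 * m) * ‖z - zs‖ := by
      rw [Real.sqrt_mul' _ (sq_nonneg _), Real.sqrt_sq (norm_nonneg _)]
end
end
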